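/- Let a, b, c, d, e, f be real numbers with 0 < a and a ≤ b, a ≤ c, a ≤ d, a ≤ e, a ≤ f. Then 1 + a + b + c + d + e + f + a·b + b·c + c·d + d·e + e·f + f·a > 6·(a + a·b + a·f − b·f)·(b + a·b + b·c − a·c)/((1+b)·(1+c+f)) + 6·(a + a·b + a·f − b·f)·(f + e·f + a·f − a·e)/(f·(1+b+e)). -/

import Mathlib

/-- If `B * F ≤ p`, the ratio `(p + B * (s + C)) / (s + C + F)` is largest at `C = 0`. -/
lemma ratio_le_of_mul_le {p s m B C F : ℝ} (hs : 0 < s) (hm : 0 < m) (hC : 0 ≤ C)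
    (hF : 0 ≤ F) (h : B * F ≤ p) :
    (p + B * (s + C)) / (m * (s + C + F)) ≤ (p + B * s) / (m * (s + F)) := by
  rw [div_le_div_iff₀ (by positivity) (by positivity)]
  linear_combination m * C * h

/-- The homogeneous three-parameter form of the inequality, with `q` in place of `1 + a`. -/
lemma homogeneous_core_inequality {a q B F : ℝ} (ha : 0 < a) (haq : a ≤ q) (hB : 0 ≤ B)
    (hF : 0 ≤ F) :
    6 * (a * q - B * F) * ((a * q + B * (a + q)) / ((q + B) * (a + q + F)) +
        (a * q + F * (a + q)) / ((a + F) * (a + q + B))) ≤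
      6 * (a * q) + (a + q) * (B + F) := by
  obtain ⟨t, rfl⟩ := exists_add_of_le haq
  have ht : 0 ≤ t := by linarith
  rw [div_add_div _ _ (by positivity) (by positivity), ← mul_div_assoc,
    div_le_iff₀ (by positivity), ← sub_nonneg]
  ring_nf
  positivity

/-- The algebraic core of the hexagon circumscription theorem: with `a` the minimal
parameter, the hexagon's area strictly exceeds six times the sum of the areas of the
two triangles `AHB` and `FGA` cut off by the circumscribed pentagon. -/
theorem hexagon_core_inequality (a b c d e f : ℝ)
    (ha : 0 < a) (hab : a ≤ b) (hac : a ≤ c) (had : a ≤ d) (hae : a ≤ e) (haf : a ≤ f) :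
    6 * (a + a * b + a * f - b * f) * (b + a * b + b * c - a * c) /
        ((1 + b) * (1 + c + f)) +
      6 * (a + a * b + a * f - b * f) * (f + e * f + a * f - a * e) /
        (f * (1 + b + e)) <
      1 + a + b + c + d + e + f + a * b + b * c + c * d + d * e + e * f + f * a := by
  obtain ⟨B, rfl⟩ := exists_add_of_le hab
  obtain ⟨C, rfl⟩ := exists_add_of_le hac
  obtain ⟨D, rfl⟩ := exists_add_of_le had
  obtain ⟨E, rfl⟩ := exists_add_of_le hae
  obtain ⟨F, rfl⟩ := exists_add_of_le haf
  simp only [le_add_iff_nonneg_right] at hab hac had hae haf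
  set p := a * (1 + a) with hp
  set s := a + (1 + a) with hs
  have hs0 : 0 < s := by positivity
  have hLHS : 6 * (a + a * (a + B) + a * (a + F) - (a + B) * (a + F)) *
        (a + B + a * (a + B) + (a + B) * (a + C) - a * (a + C)) /
        ((1 + (a + B)) * (1 + (a + C) + (a + F))) +
      6 * (a + a * (a + B) + a * (a + F) - (a + B) * (a + F)) *
        (a + F + (a + E) * (a + F) + a * (a + F) - a * (a + E)) /
        ((a + F) * (1 + (a + B) + (a + E))) =
      6 * (p - B * F) * ((p + B * (s + C)) / ((1 + a + B) * (s + C + F)) +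
        (p + F * (s + E)) / ((a + F) * (s + E + B))) := by
    rw [mul_add (6 * (p - B * F)), ← mul_div_assoc, ← mul_div_assoc, hp, hs]
    congr 2 <;> ring
  have hRHS : 1 + 6 * p + s * (B + F) ≤
      1 + a + (a + B) + (a + C) + (a + D) + (a + E) + (a + F) + a * (a + B) +
        (a + B) * (a + C) + (a + C) * (a + D) + (a + D) * (a + E) + (a + E) * (a + F) +
        (a + F) * a := by
    rw [← sub_nonneg, hp, hs]
    ring_nf
    positivity
  rw [hLHS]
  refine lt_of_lt_of_le ?_ hRHS
  rcases le_total (B * F) p with h | h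
  · have h₁ := ratio_le_of_mul_le (m := 1 + a + B) hs0 (by positivity) hac haf h
    have h₂ := ratio_le_of_mul_le (m := a + F) hs0 (by positivity) hae hab
      ((mul_comm F B).trans_le h)
    have h₃ := homogeneous_core_inequality (q := 1 + a) ha (by linarith) hab haf
    have h₄ := mul_le_mul_of_nonneg_left (add_le_add h₁ h₂)
      (by linarith : 0 ≤ 6 * (p - B * F))
    linarith
  · refine lt_of_le_of_lt (mul_nonpos_of_nonpos_of_nonneg (by linarith) ?_) ?_ <;> positivity
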